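/- Let f be a real polynomial of degree n with nonzero leading coefficient, let [D_1(f),…,D_n(f)] be its discriminant sequence, and form the revised sign list of this sequence. If K denotes the number of sign changes and L the number of nonzero members of the revised sign list, then f has exactly K distinct pairs of complex-conjugate (non-real) roots and exactly L − 2K distinct real roots. -/

import Mathlib

open Polynomial

/-- Entry `(r, c)` (0-indexed) of the discrimination matrix of a real polynomial `f`
regarded as having degree `n`.  Even rows `2*i` carry the coefficient vector
`(a₀, a₁, …, aₙ)` of `f` (where `aₘ = f.coeff (n - m)`) shifted `i` columns to the
right; odd rows `2*i+1` carry the coefficient vector `(n·a₀, (n-1)·a₁, …, a_{n-1})`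
of the derivative `f'` preceded by one zero and shifted `i` columns to the right. -/
def discEntry (n : ℕ) (f : Polynomial ℝ) (r c : ℕ) : ℝ :=
  if r % 2 = 0 then
    if r / 2 ≤ c ∧ c ≤ r / 2 + n then f.coeff (n - (c - r / 2)) else 0
  else
    if r / 2 + 1 ≤ c ∧ c ≤ r / 2 + n then
      ((n - (c - (r / 2 + 1)) : ℕ) : ℝ) * f.coeff (n - (c - (r / 2 + 1)))
    else 0

/-- The `k`-th discriminant `D_k(f)`: the determinant of the submatrix of the
discrimination matrix formed by its first `2k` rows and first `2k` columns. -/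
def discSeq (n : ℕ) (f : Polynomial ℝ) (k : ℕ) : ℝ :=
  Matrix.det (Matrix.of fun i j : Fin (2 * k) => discEntry n f i j)

/-- `sign(x)` : `1, 0, -1` according as `x > 0`, `x = 0`, `x < 0`. -/
noncomputable def signOf (x : ℝ) : ℤ := if 0 < x then 1 else if x < 0 then -1 else 0

/-- The sign list `[sign D₁(f), …, sign Dₙ(f)]` of the discriminant sequence. -/
noncomputable def signList (n : ℕ) (f : Polynomial ℝ) : List ℤ :=
  (List.range n).map fun i => signOf (discSeq n f (i + 1))

/-- The `p`-th entry of the revised sign list obtained from a sign list `s`: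
nonzero entries are unchanged; an internal zero (one with some nonzero entry before
it and some nonzero entry after it) at distance `t` from the nearest nonzero entry
`sᵢ` to its left is replaced by `(-1)^⌊(t+1)/2⌋ · sᵢ` (the period-four pattern
`-sᵢ, -sᵢ, sᵢ, sᵢ, …`); trailing zeros are unchanged. -/
noncomputable def revisedEntry (s : List ℤ) (p : ℕ) : ℤ := by
  classical
  exact
    if s.getD p 0 ≠ 0 then s.getD p 0
    else if (∃ i < p, s.getD i 0 ≠ 0) ∧ (∃ j < s.length, p < j ∧ s.getD j 0 ≠ 0) then
      (-1) ^ ((p - Nat.findGreatest (fun i => s.getD i 0 ≠ 0) p + 1) / 2) *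
        s.getD (Nat.findGreatest (fun i => s.getD i 0 ≠ 0) p) 0
    else 0

/-- The revised sign list of a sign list `s`. -/
noncomputable def revisedSignList (s : List ℤ) : List ℤ :=
  (List.range s.length).map (revisedEntry s)

/-- The number of sign changes in a list of signs. -/
def signChanges (l : List ℤ) : ℕ :=
  (l.zip l.tail).countP fun p => decide (p.1 * p.2 < 0)


noncomputable def hank (l : ℝ[X] →ₗ[ℝ] ℝ) (k : ℕ) : Matrix (Fin k) (Fin k) ℝ :=
  Matrix.of fun i j => l (X ^ ((i : ℕ) + (j : ℕ)))

noncomputable def toP (k : ℕ) (v : Fin k → ℝ) : ℝ[X] := ∑ i : Fin k, v i • X ^ (i : ℕ)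

lemma toP_mem (k : ℕ) (v : Fin k → ℝ) : toP k v ∈ degreeLT ℝ k := by
  refine Submodule.sum_mem _ fun i _ => Submodule.smul_mem _ _ ?_
  rw [mem_degreeLT, degree_X_pow]
  exact_mod_cast i.2

lemma toP_coeff (k : ℕ) (v : Fin k → ℝ) (i : Fin k) : (toP k v).coeff i = v i := by
  simp only [toP, finsetSum_coeff, coeff_smul, coeff_X_pow, smul_eq_mul, mul_ite, mul_one, mul_zero]
  rw [Finset.sum_eq_single i]
  · simp
  · intro b _ hb
    rw [if_neg]
    intro h; exact hb (Fin.ext h.symm)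
  · simp

lemma exists_toP (k : ℕ) (g : ℝ[X]) (hg : g ∈ degreeLT ℝ k) : ∃ v, toP k v = g := by
  refine ⟨fun i => g.coeff i, ?_⟩
  ext m
  by_cases hm : m < k
  · exact toP_coeff k _ ⟨m, hm⟩
  · have h1 := toP_mem k (fun i => g.coeff i)
    rw [mem_degreeLT] at h1 hg
    have hm' : (k : WithBot ℕ) ≤ m := by exact_mod_cast not_lt.1 hm
    rw [coeff_eq_zero_of_degree_lt (h1.trans_le hm'), coeff_eq_zero_of_degree_lt (hg.trans_le hm')]

lemma toP_eq_zero (k : ℕ) (v : Fin k → ℝ) : toP k v = 0 ↔ v = 0 := by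
  constructor
  · intro h; ext i; rw [← toP_coeff k v i, h]; simp
  · rintro rfl; simp [toP]

lemma l_toP (l : ℝ[X] →ₗ[ℝ] ℝ) (k : ℕ) (v w : Fin k → ℝ) :
    l (toP k v * toP k w) = v ⬝ᵥ (hank l k).mulVec w := by
  rw [toP, toP, Finset.sum_mul_sum]
  simp only [map_sum, dotProduct, Matrix.mulVec, hank, Finset.mul_sum,
    Matrix.of_apply]
  refine Finset.sum_congr rfl fun i _ => Finset.sum_congr rfl fun j _ => ?_
  rw [smul_mul_smul_comm, map_smul, ← pow_add, smul_eq_mul]; ring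

lemma hank_det_zero_iff (l : ℝ[X] →ₗ[ℝ] ℝ) (k : ℕ) : (hank l k).det = 0 ↔
    ∃ g ∈ degreeLT ℝ k, g ≠ 0 ∧ ∀ h ∈ degreeLT ℝ k, l (g * h) = 0 := by
  rw [← Matrix.exists_mulVec_eq_zero_iff]
  constructor
  · rintro ⟨v, hv, h0⟩
    refine ⟨toP k v, toP_mem k v, by rwa [Ne, toP_eq_zero], fun h hh => ?_⟩
    obtain ⟨w, rfl⟩ := exists_toP k h hh
    rw [mul_comm, l_toP, h0, dotProduct_zero]
  · rintro ⟨g, hg, hg0, h0⟩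
    obtain ⟨v, rfl⟩ := exists_toP k g hg
    refine ⟨v, by rwa [Ne, toP_eq_zero] at hg0, ?_⟩
    ext i
    have := h0 _ (toP_mem k (Pi.single i 1))
    rw [mul_comm, l_toP, single_one_dotProduct] at this
    simpa using this

lemma hank_herm (l : ℝ[X] →ₗ[ℝ] ℝ) (k : ℕ) : (hank l k).IsHermitian := by
  ext i j
  simp [hank, add_comm]

lemma hank_diag (l : ℝ[X] →ₗ[ℝ] ℝ) (k : ℕ) : ∃ (p : Fin k → ℝ[X]) (μ : Fin k → ℝ),
    LinearIndependent ℝ p ∧ (∀ i, p i ∈ degreeLT ℝ k) ∧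
    (∀ i j, l (p i * p j) = if i = j then μ i else 0) ∧ (hank l k).det = ∏ i, μ i := by
  have hH := hank_herm l k
  let b := hH.eigenvectorBasis
  refine ⟨fun i => toP k (b i), hH.eigenvalues, ?_, fun i => toP_mem _ _, ?_, ?_⟩
  · have hb := b.orthonormal.linearIndependent
    rw [Fintype.linearIndependent_iff] at hb ⊢
    intro c hc
    apply hb c
    have : toP k (∑ i, c i • b i) = ∑ i, c i • toP k (b i) := by
      simp only [toP, Finset.smul_sum]
      rw [Finset.sum_comm]
      refine Finset.sum_congr rfl fun i _ => ?_
      simp [Finset.sum_smul, mul_smul]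
    rw [hc] at this
    rw [toP_eq_zero] at this
    ext i
    simpa using congrFun this i
  · intro i j
    rw [l_toP, hH.mulVec_eigenvectorBasis, dotProduct_smul]
    have := orthonormal_iff_ite.1 b.orthonormal i j
    rw [EuclideanSpace.inner_eq_star_dotProduct] at this
    rw [dotProduct_comm]
    simp at this
    change _ • ((b j).ofLp ⬝ᵥ (b i).ofLp) = _
    rw [this]
    split_ifs with h <;> simp [h]
  · simpa using hH.det_eq_prod_eigenvalues

def Inertia (l : ℝ[X] →ₗ[ℝ] ℝ) (k ν : ℕ) : Prop :=
  (∃ N P : Submodule ℝ ℝ[X], N ≤ degreeLT ℝ k ∧ P ≤ degreeLT ℝ k ∧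
    Module.finrank ℝ N = ν ∧ Module.finrank ℝ P + ν = k ∧
    (∀ g ∈ N, g ≠ 0 → l (g * g) < 0) ∧ (∀ g ∈ P, g ≠ 0 → 0 < l (g * g))) ∧
  0 < (-1) ^ ν * (hank l k).det

instance finDegLT (k : ℕ) : FiniteDimensional ℝ (degreeLT ℝ k) :=
  Module.Finite.equiv (degreeLTEquiv ℝ k).symm

lemma finrank_degLT (k : ℕ) : Module.finrank ℝ (degreeLT ℝ k) = k := by
  rw [(degreeLTEquiv ℝ k).finrank_eq]; simp

lemma finDim_of_le {k : ℕ} {N : Submodule ℝ ℝ[X]} (h : N ≤ degreeLT ℝ k) :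
    FiniteDimensional ℝ N := Submodule.finiteDimensional_of_le h

lemma dim_add_le {k : ℕ} {N P : Submodule ℝ ℝ[X]} (hN : N ≤ degreeLT ℝ k) (hP : P ≤ degreeLT ℝ k)
    (h : ∀ g ∈ N, g ∈ P → g = 0) : Module.finrank ℝ N + Module.finrank ℝ P ≤ k ∧
      Module.finrank ℝ (N ⊔ P : Submodule ℝ ℝ[X]) = Module.finrank ℝ N + Module.finrank ℝ P := by
  have := finDim_of_le hN
  have := finDim_of_le hP
  have h1 := Submodule.finrank_sup_add_finrank_inf_eq N P
  have h2 : N ⊓ P = ⊥ := by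
    rw [eq_bot_iff]; intro g hg; exact (Submodule.mem_bot ℝ).2 (h g hg.1 hg.2)
  rw [h2, finrank_bot] at h1
  have h3 := Submodule.finrank_mono (sup_le hN hP)
  rw [finrank_degLT] at h3
  omega

lemma l_sum_sq (l : ℝ[X] →ₗ[ℝ] ℝ) {k : ℕ} (p : Fin k → ℝ[X]) (μ : Fin k → ℝ)
    (h : ∀ i j, l (p i * p j) = if i = j then μ i else 0) (c : Fin k → ℝ) :
    l ((∑ i, c i • p i) * (∑ i, c i • p i)) = ∑ i, μ i * (c i) ^ 2 := by
  rw [Finset.sum_mul_sum]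
  simp only [map_sum, smul_mul_smul_comm, map_smul, h, smul_eq_mul, mul_ite, mul_zero,
    Finset.sum_ite_eq, Finset.mem_univ, if_true]
  exact Finset.sum_congr rfl fun i _ => by ring

lemma span_aux {k : ℕ} (p : Fin k → ℝ[X]) (hp : LinearIndependent ℝ p) (s : Finset (Fin k)) :
    Module.finrank ℝ (Submodule.span ℝ (p '' (s : Set (Fin k)))) = s.card ∧
    ∀ g ∈ Submodule.span ℝ (p '' (s : Set (Fin k))), ∃ c : Fin k → ℝ, (∀ i, i ∉ s → c i = 0) ∧
      g = ∑ i, c i • p i := by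
  constructor
  · have h1 : LinearIndependent ℝ (fun i : s => p i) := hp.comp _ Subtype.val_injective
    have h2 := finrank_span_eq_card h1
    have h3 : Set.range (fun i : s => p i) = p '' (s : Set (Fin k)) := by
      ext x; simp
    rw [h3] at h2
    simpa using h2
  · intro g hg
    rw [Submodule.mem_span_image_finset_iff_exists_fun] at hg
    obtain ⟨c, rfl⟩ := hg
    refine ⟨fun i => if h : i ∈ s then c ⟨i, h⟩ else 0, fun i hi => by simp [hi], ?_⟩
    rw [← Finset.sum_subset (Finset.subset_univ s)]
    · rw [← Finset.sum_coe_sort s]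
      refine Finset.sum_congr rfl fun i _ => by simp
    · intro i _ hi; simp [hi]

lemma exists_inertia (l : ℝ[X] →ₗ[ℝ] ℝ) (k : ℕ) (hd : (hank l k).det ≠ 0) :
    ∃ ν, Inertia l k ν := by
  obtain ⟨p, μ, hp, hm, ho, hdet⟩ := hank_diag l k
  have hμ : ∀ i, μ i ≠ 0 := by
    intro i; rw [hdet, Finset.prod_ne_zero_iff] at hd; exact hd i (Finset.mem_univ i)
  let s : Finset (Fin k) := Finset.univ.filter fun i => μ i < 0
  let t : Finset (Fin k) := Finset.univ.filter fun i => ¬ μ i < 0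
  have hst : s.card + t.card = k := by
    have : s.card + t.card = _ := Finset.card_filter_add_card_filter_not (s := (Finset.univ : Finset (Fin k))) (fun i => μ i < 0)
    rw [this]; simp
  refine ⟨s.card, ⟨Submodule.span ℝ (p '' (s : Set (Fin k))), Submodule.span ℝ (p '' (t : Set (Fin k))),
    ?_, ?_, (span_aux p hp s).1, ?_, ?_, ?_⟩, ?_⟩
  · rw [Submodule.span_le]; rintro _ ⟨i, _, rfl⟩; exact hm i
  · rw [Submodule.span_le]; rintro _ ⟨i, _, rfl⟩; exact hm i
  · rw [(span_aux p hp t).1]; omega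
  · intro g hg hg0
    obtain ⟨c, hc, rfl⟩ := (span_aux p hp s).2 g hg
    rw [l_sum_sq l p μ ho]
    apply Finset.sum_neg'
    · intro i _
      by_cases hi : i ∈ s
      · have : μ i < 0 := by simpa [s] using hi
        nlinarith [sq_nonneg (c i)]
      · simp [hc i hi]
    · by_contra! hcon
      apply hg0
      refine Finset.sum_eq_zero fun i _ => ?_
      by_cases hi : i ∈ s
      · have h1 : μ i < 0 := by simpa [s] using hi
        have := hcon i (Finset.mem_univ i)
        have h2 : c i ^ 2 ≤ 0 := by nlinarith
        have h3 : c i = 0 := by nlinarith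
        simp [h3]
      · simp [hc i hi]
  · intro g hg hg0
    obtain ⟨c, hc, rfl⟩ := (span_aux p hp t).2 g hg
    rw [l_sum_sq l p μ ho]
    apply Finset.sum_pos'
    · intro i _
      by_cases hi : i ∈ t
      · have : ¬ μ i < 0 := by simpa [t] using hi
        nlinarith [sq_nonneg (c i)]
      · simp [hc i hi]
    · by_contra! hcon
      apply hg0
      refine Finset.sum_eq_zero fun i _ => ?_
      by_cases hi : i ∈ t
      · have h1 : ¬ μ i < 0 := by simpa [t] using hi
        have h1' : 0 < μ i := lt_of_le_of_ne (not_lt.1 h1) (hμ i).symm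
        have := hcon i (Finset.mem_univ i)
        have h2 : c i ^ 2 ≤ 0 := by nlinarith
        have h3 : c i = 0 := by nlinarith
        simp [h3]
      · simp [hc i hi]
  · rw [hdet, ← Finset.prod_filter_mul_prod_filter_not Finset.univ (fun i => μ i < 0), ← mul_assoc,
      ← Finset.prod_const, ← Finset.prod_mul_distrib]
    apply mul_pos
    · apply Finset.prod_pos
      intro i hi
      have : μ i < 0 := by simpa [s] using hi
      linarith
    · apply Finset.prod_pos
      intro i hi
      have : ¬ μ i < 0 := by simpa using hi
      exact lt_of_le_of_ne (not_lt.1 this) (hμ i).symm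

lemma inertia_ge {l : ℝ[X] →ₗ[ℝ] ℝ} {k ν : ℕ} (h : Inertia l k ν) (N : Submodule ℝ ℝ[X])
    (hN : N ≤ degreeLT ℝ k) (hl : ∀ g ∈ N, l (g * g) ≤ 0) : Module.finrank ℝ N ≤ ν := by
  obtain ⟨⟨_, P, _, hP, _, hd, _, hpos⟩, _⟩ := h
  have := (dim_add_le hN hP (fun g h1 h2 => by
    by_contra h0; linarith [hl g h1, hpos g h2 h0])).1
  omega

lemma inertia_le {l : ℝ[X] →ₗ[ℝ] ℝ} {k ν : ℕ} (h : Inertia l k ν) (P : Submodule ℝ ℝ[X])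
    (hP : P ≤ degreeLT ℝ k) (hl : ∀ g ∈ P, 0 ≤ l (g * g)) : Module.finrank ℝ P + ν ≤ k := by
  obtain ⟨⟨N, _, hN, _, hd, _, hneg, _⟩, _⟩ := h
  have := (dim_add_le hP hN (fun g h1 h2 => by
    by_contra h0; linarith [hl g h1, hneg g h2 h0])).1
  omega

lemma mem_degreeLT_of_mul {a b m : ℕ} {g h : ℝ[X]} (hg : g ∈ degreeLT ℝ a) (hh : h ∈ degreeLT ℝ b)
    (hm : a + b ≤ m + 1) : g * h ∈ degreeLT ℝ m := by
  by_cases h0 : g * h = 0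
  · rw [h0]; exact Submodule.zero_mem _
  have hg0 := left_ne_zero_of_mul h0
  have hh0 := right_ne_zero_of_mul h0
  rw [mem_degreeLT, ← natDegree_lt_iff_degree_lt (by assumption)] at *
  rw [natDegree_mul hg0 hh0]; omega

lemma inertia_gap {l : ℝ[X] →ₗ[ℝ] ℝ} {k d ν ν' : ℕ} (h : Inertia l k ν) (h' : Inertia l (k + d) ν')
    (hd : 0 < d) (q : ℝ[X]) (hq : q.Monic) (hqd : q.natDegree = k)
    (hq0 : ∀ g ∈ degreeLT ℝ (k + d - 1), l (q * g) = 0) : ν + d / 2 ≤ ν' ∧ ν' ≤ ν + (d + 1) / 2 := by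
  let I : Submodule ℝ ℝ[X] := (degreeLT ℝ (d / 2)).map (LinearMap.mulLeft ℝ q)
  have hqm : q ∈ degreeLT ℝ (k + 1) := by
    rw [mem_degreeLT, ← natDegree_lt_iff_degree_lt hq.ne_zero]; omega
  have hIle : I ≤ degreeLT ℝ (k + d) := by
    rintro _ ⟨a, ha, rfl⟩
    exact mem_degreeLT_of_mul hqm ha (by omega)
  have hIdim : Module.finrank ℝ I = d / 2 := by
    rw [← (Submodule.equivMapOfInjective (LinearMap.mulLeft ℝ q)
      (mul_right_injective₀ hq.ne_zero) (degreeLT ℝ (d / 2))).finrank_eq, finrank_degLT]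
  have hmono : degreeLT ℝ k ≤ degreeLT ℝ (k + d) := degreeLT_mono (by omega)
  have hdisj : ∀ g ∈ degreeLT ℝ k, g ∈ I → g = 0 := by
    rintro _ hg ⟨a, ha, rfl⟩
    by_contra h0
    rw [mem_degreeLT, ← natDegree_lt_iff_degree_lt h0] at hg
    simp only [LinearMap.mulLeft_apply] at hg h0
    rw [natDegree_mul hq.ne_zero (right_ne_zero_of_mul h0)] at hg
    omega
  have hsq : ∀ u ∈ degreeLT ℝ k, ∀ g ∈ I, l ((u + g) * (u + g)) = l (u * u) := by
    rintro u hu _ ⟨a, ha, rfl⟩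
    simp only [LinearMap.mulLeft_apply]
    have e : (u + q * a) * (u + q * a) = u * u + (q * (a * u) + q * (a * u) + q * (a * (q * a))) := by ring
    have h1 : l (q * (a * u)) = 0 := hq0 _ (mem_degreeLT_of_mul ha hu (by omega))
    have h2 : l (q * (a * (q * a))) = 0 := by
      by_cases h0 : d / 2 = 0
      · rw [h0, SetLike.mem_coe, mem_degreeLT] at ha
        have : a = 0 := by
          rw [← degree_eq_bot]; simpa using ha
        simp [this]
      refine hq0 _ (mem_degreeLT_of_mul (b := k + d / 2) ha (mem_degreeLT_of_mul hqm ha ?_) ?_) <;> omega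
    rw [e, map_add, map_add, map_add, h1, h2]; ring
  obtain ⟨⟨N, P, hN, hP, hNd, hPd, hn, hp⟩, _⟩ := h
  constructor
  · have e1 := (dim_add_le (hN.trans hmono) hIle fun g h1 h2 => hdisj g (hN h1) h2).2
    have := inertia_ge h' (N ⊔ I) (sup_le (hN.trans hmono) hIle) (by
      intro g hg
      obtain ⟨u, hu, i, hi, rfl⟩ := Submodule.mem_sup.1 hg
      rw [hsq u (hN hu) i hi]
      by_cases h0 : u = 0
      · simp [h0]
      · exact (hn u hu h0).le)
    omega
  · have e1 := (dim_add_le (hP.trans hmono) hIle fun g h1 h2 => hdisj g (hP h1) h2).2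
    have := inertia_le h' (P ⊔ I) (sup_le (hP.trans hmono) hIle) (by
      intro g hg
      obtain ⟨u, hu, i, hi, rfl⟩ := Submodule.mem_sup.1 hg
      rw [hsq u (hP hu) i hi]
      by_cases h0 : u = 0
      · simp [h0]
      · exact (hp u hu h0).le)
    omega

lemma exists_orth (l : ℝ[X] →ₗ[ℝ] ℝ) (k : ℕ) (hd : (hank l k).det ≠ 0) :
    ∃ q : ℝ[X], q.Monic ∧ q.natDegree = k ∧ ∀ j < k, l (q * X ^ j) = 0 := by
  let w : Fin k → ℝ := fun i => l (X ^ k * X ^ (i : ℕ))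
  let v := (hank l k)⁻¹.mulVec w
  have hv : (hank l k).mulVec v = w := by
    simp only [v]
    rw [Matrix.mulVec_mulVec, Matrix.mul_nonsing_inv _ (isUnit_iff_ne_zero.2 hd), Matrix.one_mulVec]
  have hlt : (toP k v).degree < (X ^ k : ℝ[X]).degree := by
    rw [degree_X_pow]; exact mem_degreeLT.1 (toP_mem k v)
  refine ⟨X ^ k - toP k v, (monic_X_pow k).sub_of_left hlt, ?_, ?_⟩
  · rw [natDegree_eq_of_degree_eq (degree_sub_eq_left_of_degree_lt hlt), natDegree_X_pow]
  · intro j hj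
    have h1 := l_toP l k (Pi.single ⟨j, hj⟩ 1) v
    rw [single_one_dotProduct, hv] at h1
    have h2 : toP k (Pi.single ⟨j, hj⟩ 1) = X ^ j := by
      simp only [toP]
      rw [Finset.sum_eq_single ⟨j, hj⟩]
      · simp
      · intro b _ hb; simp [hb]
      · simp
    rw [h2, mul_comm] at h1
    rw [sub_mul, map_sub, h1, sub_self]

lemma orth_extend (l : ℝ[X] →ₗ[ℝ] ℝ) (k : ℕ) (hd : (hank l k).det ≠ 0) (q : ℝ[X]) (hq : q.Monic)
    (hqd : q.natDegree = k) (h0 : ∀ j < k, l (q * X ^ j) = 0) (d : ℕ)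
    (hz : ∀ t, t + 1 < d → (hank l (k + t + 1)).det = 0) : ∀ j < k + d - 1, l (q * X ^ j) = 0 := by
  intro j
  induction j using Nat.strong_induction_on with
  | _ j ih =>
  intro hj
  by_cases hjk : j < k
  · exact h0 j hjk
  obtain ⟨t, rfl⟩ := Nat.exists_eq_add_of_le (not_lt.1 hjk)
  by_contra hc
  obtain ⟨g, hg, hg0, hgl⟩ := (hank_det_zero_iff _ _).1 (hz t (by omega))
  rw [mem_degreeLT, ← natDegree_lt_iff_degree_lt hg0] at hg
  by_cases he : g.natDegree < k
  · apply hd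
    rw [hank_det_zero_iff]
    refine ⟨g, ?_, hg0, fun h hh => hgl h ((degreeLT_mono (by omega)) hh)⟩
    rwa [mem_degreeLT, ← natDegree_lt_iff_degree_lt hg0]
  · obtain ⟨a, ha⟩ : ∃ a, a + g.natDegree = k + t := ⟨k + t - g.natDegree, by omega⟩
    have h1 : l (g * (X ^ a * q)) = 0 := by
      apply hgl
      rw [mem_degreeLT, ← natDegree_lt_iff_degree_lt (mul_ne_zero (pow_ne_zero _ X_ne_zero) hq.ne_zero),
        natDegree_mul (pow_ne_zero _ X_ne_zero) hq.ne_zero, natDegree_X_pow]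
      omega
    have h2 : g * (X ^ a * q) = ∑ i ∈ Finset.range (g.natDegree + 1), g.coeff i • (q * X ^ (a + i)) := by
      conv_lhs => rw [g.as_sum_range_C_mul_X_pow]
      rw [Finset.sum_mul]
      refine Finset.sum_congr rfl fun i _ => ?_
      rw [smul_eq_C_mul]; ring
    rw [h2, Finset.sum_range_succ, map_add, map_sum, Finset.sum_eq_zero, zero_add, map_smul, ha,
      smul_eq_mul, mul_eq_zero] at h1
    · rcases h1 with h1 | h1
      · exact hg0 (leadingCoeff_eq_zero.1 h1)
      · exact hc h1
    · intro i hi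
      have := Finset.mem_range.1 hi
      rw [map_smul, ih (a + i) (by omega) (by omega), smul_zero]

lemma inertia_step {l : ℝ[X] →ₗ[ℝ] ℝ} {k d ν ν' : ℕ} (h : Inertia l k ν) (h' : Inertia l (k + d) ν')
    (hd : 0 < d) (hz : ∀ t, t + 1 < d → (hank l (k + t + 1)).det = 0) :
    ν + d / 2 ≤ ν' ∧ ν' ≤ ν + (d + 1) / 2 := by
  have hdk : (hank l k).det ≠ 0 := by
    intro h0; have := h.2; rw [h0] at this; simp at this
  obtain ⟨q, hq, hqd, hq0⟩ := exists_orth l k hdk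
  have := orth_extend l k hdk q hq hqd hq0 d hz
  refine inertia_gap h h' hd q hq hqd ?_
  intro g hg
  obtain ⟨v, rfl⟩ := exists_toP _ g hg
  rw [toP, Finset.mul_sum, map_sum]
  refine Finset.sum_eq_zero fun i _ => ?_
  rw [mul_smul_comm, map_smul, this i i.2, smul_zero]

noncomputable def ellR (R : Multiset ℂ) : ℝ[X] →ₗ[ℝ] ℝ where
  toFun g := ((R.map fun z => aeval z g).sum).re
  map_add' g h := by simp
  map_smul' c g := by
    induction R using Multiset.induction_on with
    | empty => simp
    | cons a R ih => simp at ih; simp [ih, mul_add]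

lemma re_msum (R : Multiset ℂ) (F : ℂ → ℂ) : ((R.map F).sum).re = (R.map fun z => (F z).re).sum := by
  induction R using Multiset.induction_on with
  | empty => simp
  | cons a R ih => simp [ih]

lemma ellR_apply (R : Multiset ℂ) (g : ℝ[X]) : ellR R g = (R.map fun z => (aeval z g).re).sum :=
  re_msum R _

lemma ellR_pos (R : Multiset ℂ) (g : ℝ[X]) (h : ∀ z ∈ R, (aeval z g).im = 0)
    (h1 : ∃ z ∈ R, aeval z g ≠ 0) : 0 < ellR R (g * g) := by
  obtain ⟨z, hz, hne⟩ := h1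
  have hre : (aeval z g).re ≠ 0 := fun h0 => hne (Complex.ext h0 (h z hz))
  rw [ellR_apply]
  have key : ∀ w ∈ R, (aeval w (g * g)).re = (aeval w g).re ^ 2 := by
    intro w hw; rw [map_mul, Complex.mul_re, h w hw]; ring
  have h2 : (aeval z (g * g)).re ≤ (R.map fun z => (aeval z (g * g)).re).sum := by
    apply Multiset.single_le_sum
    · intro x hx
      obtain ⟨w, hw, rfl⟩ := Multiset.mem_map.1 hx
      rw [key w hw]; positivity
    · exact Multiset.mem_map.2 ⟨z, hz, rfl⟩
  rw [key z hz] at h2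
  have : 0 < (aeval z g).re ^ 2 := by positivity
  linarith

lemma ellR_neg (R : Multiset ℂ) (g : ℝ[X]) (h : ∀ z ∈ R, (aeval z g).re = 0)
    (h1 : ∃ z ∈ R, aeval z g ≠ 0) : ellR R (g * g) < 0 := by
  obtain ⟨z, hz, hne⟩ := h1
  have hre : (aeval z g).im ≠ 0 := fun h0 => hne (Complex.ext (h z hz) h0)
  have key : ∀ w ∈ R, -(aeval w (g * g)).re = (aeval w g).im ^ 2 := by
    intro w hw; rw [map_mul, Complex.mul_re, h w hw]; ring
  have h2 : -(aeval z (g * g)).re ≤ (R.map fun z => -(aeval z (g * g)).re).sum := by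
    apply Multiset.single_le_sum
    · intro x hx
      obtain ⟨w, hw, rfl⟩ := Multiset.mem_map.1 hx
      rw [key w hw]; positivity
    · exact Multiset.mem_map.2 ⟨z, hz, rfl⟩
  rw [key z hz, Multiset.sum_map_neg, ← ellR_apply] at h2
  have : 0 < (aeval z g).im ^ 2 := by positivity
  linarith

lemma ker_dim {W : Type} [AddCommGroup W] [Module ℝ W] [FiniteDimensional ℝ W]
    (T : ℝ[X] →ₗ[ℝ] W) (k : ℕ) :
    k ≤ Module.finrank ℝ (degreeLT ℝ k ⊓ LinearMap.ker T : Submodule ℝ ℝ[X]) + Module.finrank ℝ W := by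
  have h1 := LinearMap.finrank_range_add_finrank_ker (T.domRestrict (degreeLT ℝ k))
  have h2 := Submodule.finrank_le (LinearMap.range (T.domRestrict (degreeLT ℝ k)))
  have h3 : Module.finrank ℝ (LinearMap.ker (T.domRestrict (degreeLT ℝ k))) =
      Module.finrank ℝ (degreeLT ℝ k ⊓ LinearMap.ker T : Submodule ℝ ℝ[X]) := by
    rw [LinearMap.ker_domRestrict, ← Submodule.finrank_map_subtype_eq, Submodule.map_comap_subtype]
  rw [finrank_degLT] at h1
  omega

noncomputable def rootsC (f : ℝ[X]) : Multiset ℂ := (f.map (algebraMap ℝ ℂ)).roots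

noncomputable def upR (f : ℝ[X]) : Finset ℂ := (rootsC f).toFinset.filter fun z => 0 < z.im

lemma mem_rootsC {f : ℝ[X]} (hf : f ≠ 0) {z : ℂ} : z ∈ rootsC f ↔ aeval z f = 0 := by
  rw [rootsC, mem_roots (map_ne_zero hf), IsRoot, eval_map_algebraMap]

lemma conj_mem {f : ℝ[X]} (hf : f ≠ 0) {z : ℂ} (h : z ∈ rootsC f) : star z ∈ rootsC f := by
  rw [mem_rootsC hf] at *
  have := aeval_conj f z
  simpa [h] using this

lemma aeval_ofReal' (g : ℝ[X]) (x : ℝ) : aeval (x : ℂ) g = ((eval x g : ℝ) : ℂ) := by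
  have := aeval_algebraMap_apply ℂ x g
  simpa [← coe_aeval_eq_eval] using this

lemma real_mem {f : ℝ[X]} (hf : f ≠ 0) {x : ℝ} : (x : ℂ) ∈ rootsC f ↔ x ∈ f.roots := by
  rw [mem_rootsC hf, mem_roots hf, IsRoot, aeval_ofReal']; simp

lemma card_im_ne {f : ℝ[X]} (hf : f ≠ 0) :
    ((rootsC f).toFinset.filter fun z => z.im ≠ 0).card = 2 * (upR f).card := by
  have h1 : ((rootsC f).toFinset.filter fun z => z.im ≠ 0) =
      upR f ∪ (upR f).image star := by
    ext z
    simp only [upR, Finset.mem_filter, Multiset.mem_toFinset, Finset.mem_union, Finset.mem_image]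
    constructor
    · rintro ⟨hz, him⟩
      rcases lt_or_gt_of_ne him with h | h
      · right; exact ⟨star z, ⟨conj_mem hf hz, by simpa using h⟩, star_star z⟩
      · left; exact ⟨hz, h⟩
    · rintro (⟨hz, him⟩ | ⟨w, ⟨hw, him⟩, rfl⟩)
      · exact ⟨hz, him.ne'⟩
      · exact ⟨conj_mem hf hw, by simpa using him.ne'⟩
  rw [h1, Finset.card_union_of_disjoint, Finset.card_image_of_injective _ star_injective]
  · ring
  · rw [Finset.disjoint_left]
    intro z hz hz'
    simp only [upR, Finset.mem_filter, Finset.mem_image] at hz hz'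
    obtain ⟨w, ⟨_, hw⟩, rfl⟩ := hz'
    have := hz.2
    simp at this; linarith

lemma card_im_eq {f : ℝ[X]} (hf : f ≠ 0) :
    ((rootsC f).toFinset.filter fun z => ¬ z.im ≠ 0).card = f.roots.toFinset.card := by
  rw [← Finset.card_image_of_injective f.roots.toFinset Complex.ofReal_injective]
  congr 1
  ext z
  simp only [Finset.mem_filter, Multiset.mem_toFinset, Finset.mem_image, not_not]
  constructor
  · rintro ⟨hz, him⟩
    have : ((z.re : ℝ) : ℂ) = z := Complex.ext rfl (by simp [him])
    exact ⟨z.re, (real_mem hf).1 (by rwa [this]), this⟩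
  · rintro ⟨x, hx, rfl⟩
    exact ⟨(real_mem hf).2 hx, by simp⟩

noncomputable def rk (f : ℝ[X]) : ℕ := f.roots.toFinset.card + 2 * (upR f).card

lemma card_S {f : ℝ[X]} (hf : f ≠ 0) : (rootsC f).toFinset.card = rk f := by
  have := Finset.card_filter_add_card_filter_not (s := (rootsC f).toFinset) (fun z => z.im ≠ 0)
  rw [card_im_ne hf, card_im_eq hf] at this
  rw [rk]; omega

/-- a property stable under conjugation holds at all roots if it does at real and upper ones -/
lemma all_roots {f : ℝ[X]} (hf : f ≠ 0) (Q : ℂ → Prop) (hQ : ∀ z, Q z → Q (star z))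
    (h1 : ∀ x ∈ f.roots, Q (x : ℂ)) (h2 : ∀ z ∈ upR f, Q z) : ∀ z ∈ rootsC f, Q z := by
  intro z hz
  rcases lt_trichotomy z.im 0 with h | h | h
  · have := hQ _ (h2 (star z) (by
      simp only [upR, Finset.mem_filter, Multiset.mem_toFinset]
      exact ⟨conj_mem hf hz, by simpa using h⟩))
    simpa using this
  · have e : ((z.re : ℝ) : ℂ) = z := Complex.ext rfl (by simp [h])
    rw [← e]; exact h1 _ ((real_mem hf).1 (by rwa [e]))
  · exact h2 z (by
      simp only [upR, Finset.mem_filter, Multiset.mem_toFinset]; exact ⟨hz, h⟩)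

lemma exists_nonvanish {f : ℝ[X]} (hf : f ≠ 0) {g : ℝ[X]} (hg : g ∈ degreeLT ℝ (rk f)) (hg0 : g ≠ 0) :
    ∃ z ∈ rootsC f, aeval z g ≠ 0 := by
  by_contra! h
  have h1 : (rootsC f).toFinset ⊆ (rootsC g).toFinset := by
    intro z hz
    rw [Multiset.mem_toFinset] at *
    exact (mem_rootsC hg0).2 (h z hz)
  have h2 := Finset.card_le_card h1
  rw [card_S hf] at h2
  have h3 := Multiset.toFinset_card_le (rootsC g)
  have h4 : (rootsC g).card ≤ _ := card_roots' (g.map (algebraMap ℝ ℂ))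
  rw [natDegree_map] at h4
  rw [mem_degreeLT, ← natDegree_lt_iff_degree_lt hg0] at hg
  omega

noncomputable def T1 (f : ℝ[X]) : ℝ[X] →ₗ[ℝ] (upR f → ℝ) :=
  LinearMap.pi fun z => Complex.imLm ∘ₗ (aeval (z : ℂ) : ℝ[X] →ₐ[ℝ] ℂ).toLinearMap

noncomputable def T1' (f : ℝ[X]) : ℝ[X] →ₗ[ℝ] (upR f → ℝ) :=
  LinearMap.pi fun z => Complex.reLm ∘ₗ (aeval (z : ℂ) : ℝ[X] →ₐ[ℝ] ℂ).toLinearMap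

noncomputable def T0 (f : ℝ[X]) : ℝ[X] →ₗ[ℝ] (f.roots.toFinset → ℝ) :=
  LinearMap.pi fun x => leval (x : ℝ)

lemma T1_zero {f g : ℝ[X]} (h : T1 f g = 0) : ∀ z ∈ upR f, (aeval z g).im = 0 :=
  fun z hz => congrFun h ⟨z, hz⟩

lemma T1'_zero {f g : ℝ[X]} (h : T1' f g = 0) : ∀ z ∈ upR f, (aeval z g).re = 0 :=
  fun z hz => congrFun h ⟨z, hz⟩

lemma T0_zero {f g : ℝ[X]} (h : T0 f g = 0) : ∀ x ∈ f.roots, aeval (x : ℂ) g = 0 := by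
  intro x hx
  have : eval x g = 0 := congrFun h ⟨x, by simpa using hx⟩
  rw [aeval_ofReal', this]; simp

lemma star_aeval (g : ℝ[X]) (z : ℂ) : aeval (star z) g = star (aeval z g) := aeval_conj g z

lemma hank_zero_of_gt {f : ℝ[X]} (hf : f ≠ 0) {k : ℕ} (hk : rk f < k) :
    (hank (ellR (rootsC f)) k).det = 0 := by
  let T := (T0 f).prod ((T1 f).prod (T1' f))
  have hd := ker_dim T k
  have hW : Module.finrank ℝ ((f.roots.toFinset → ℝ) × (upR f → ℝ) × (upR f → ℝ)) = rk f := by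
    simp [rk]; ring
  rw [hW] at hd
  have hne : (degreeLT ℝ k ⊓ LinearMap.ker T : Submodule ℝ ℝ[X]) ≠ ⊥ := by
    intro h; rw [h, finrank_bot] at hd; omega
  obtain ⟨g, hg, hg0⟩ := Submodule.exists_mem_ne_zero_of_ne_bot hne
  rw [hank_det_zero_iff]
  refine ⟨g, hg.1, hg0, fun h _ => ?_⟩
  have hT : T g = 0 := hg.2
  have a0 : T0 f g = 0 := congrArg Prod.fst hT
  have a1 : T1 f g = 0 := congrArg (fun p => p.2.1) hT
  have a2 : T1' f g = 0 := congrArg (fun p => p.2.2) hT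
  have hall : ∀ z ∈ rootsC f, aeval z g = 0 := by
    apply all_roots hf
    · intro z hz; rw [star_aeval, hz, star_zero]
    · exact T0_zero a0
    · intro z hz; exact Complex.ext (T1'_zero a2 z hz) (T1_zero a1 z hz)
  rw [ellR_apply]
  apply Multiset.sum_eq_zero
  intro x hx
  obtain ⟨z, hz, rfl⟩ := Multiset.mem_map.1 hx
  simp [hall z hz]

lemma exists_PN {f : ℝ[X]} (hf : f ≠ 0) : ∃ N P : Submodule ℝ ℝ[X],
    N ≤ degreeLT ℝ (rk f) ∧ P ≤ degreeLT ℝ (rk f) ∧ (upR f).card ≤ Module.finrank ℝ N ∧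
    rk f ≤ Module.finrank ℝ P + (upR f).card ∧
    (∀ g ∈ N, g ≠ 0 → ellR (rootsC f) (g * g) < 0) ∧
    (∀ g ∈ P, g ≠ 0 → 0 < ellR (rootsC f) (g * g)) := by
  refine ⟨degreeLT ℝ (rk f) ⊓ LinearMap.ker ((T0 f).prod (T1' f)),
    degreeLT ℝ (rk f) ⊓ LinearMap.ker (T1 f), inf_le_left, inf_le_left, ?_, ?_, ?_, ?_⟩
  · have := ker_dim ((T0 f).prod (T1' f)) (rk f)
    simp only [Module.finrank_prod, Module.finrank_fintype_fun_eq_card, Fintype.card_coe] at this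
    have e : rk f = f.roots.toFinset.card + 2 * (upR f).card := rfl
    omega
  · simpa using ker_dim (T1 f) (rk f)
  · intro g hg hg0
    have hT : ((T0 f).prod (T1' f)) g = 0 := hg.2
    have a0 : T0 f g = 0 := congrArg Prod.fst hT
    have a2 : T1' f g = 0 := congrArg (fun p => p.2) hT
    apply ellR_neg _ _ _ (exists_nonvanish hf hg.1 hg0)
    apply all_roots hf
    · intro z hz; rw [star_aeval]; simpa using hz
    · intro x hx; rw [T0_zero a0 x hx]; rfl
    · exact T1'_zero a2
  · intro g hg hg0
    have a1 : T1 f g = 0 := hg.2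
    apply ellR_pos _ _ _ (exists_nonvanish hf hg.1 hg0)
    apply all_roots hf
    · intro z hz; rw [star_aeval]; simpa using hz
    · intro x hx; rw [aeval_ofReal']; simp
    · exact T1_zero a1

lemma hank_rk_ne {f : ℝ[X]} (hf : f ≠ 0) : (hank (ellR (rootsC f)) (rk f)).det ≠ 0 := by
  obtain ⟨N, P, hN, hP, hNd, hPd, hn, hp⟩ := exists_PN hf
  have h1 := (dim_add_le hN hP (fun g h1 h2 => by
    by_contra h0; linarith [hn g h1 h0, hp g h2 h0]))
  have h2 : N ⊔ P = degreeLT ℝ (rk f) := by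
    apply Submodule.eq_of_le_of_finrank_le (sup_le hN hP)
    rw [finrank_degLT]; omega
  intro hdet
  obtain ⟨g, hg, hg0, h0⟩ := (hank_det_zero_iff _ _).1 hdet
  rw [← h2] at hg
  obtain ⟨u, hu, v, hv, rfl⟩ := Submodule.mem_sup.1 hg
  have h3 := h0 (v - u) (Submodule.sub_mem _ (hP hv) (hN hu))
  rw [show (u + v) * (v - u) = v * v - u * u by ring, map_sub] at h3
  have hu0 : u = 0 := by
    by_contra hu0
    have := hn u hu hu0
    by_cases hv0 : v = 0
    · rw [hv0] at h3; simp at h3; linarith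
    · linarith [hp v hv hv0]
  have hv0 : v = 0 := by
    by_contra hv0
    rw [hu0] at h3; simp at h3
    linarith [hp v hv hv0]
  exact hg0 (by simp [hu0, hv0])

lemma inertia_rk {f : ℝ[X]} (hf : f ≠ 0) {ν : ℕ} (h : Inertia (ellR (rootsC f)) (rk f) ν) :
    ν = (upR f).card := by
  obtain ⟨N, P, hN, hP, hNd, hPd, hn, hp⟩ := exists_PN hf
  have h1 := inertia_ge h N hN (fun g hg => by
    by_cases h0 : g = 0
    · simp [h0]
    · exact (hn g hg h0).le)
  have h2 := inertia_le h P hP (fun g hg => by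
    by_cases h0 : g = 0
    · simp [h0]
    · exact (hp g hg h0).le)
  omega

noncomputable def geo (z : ℂ) : PowerSeries ℂ := PowerSeries.mk fun j => z ^ j

lemma geo_mul (z : ℂ) : (1 - PowerSeries.C z * PowerSeries.X) * geo z = 1 := by
  ext m
  rw [sub_mul, one_mul, mul_assoc]
  cases m with
  | zero => simp [geo]
  | succ m =>
    simp [geo, PowerSeries.coeff_succ_X_mul, PowerSeries.coeff_one, pow_succ, mul_comm]

noncomputable def fprod (R : Multiset ℂ) : PowerSeries ℂ :=
  (R.map fun z => 1 - PowerSeries.C z * PowerSeries.X).prod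

lemma newton_ps (R : Multiset ℂ) :
    (R.card : PowerSeries ℂ) * fprod R - PowerSeries.X * PowerSeries.derivative ℂ (fprod R) =
      fprod R * (R.map geo).sum := by
  induction R using Multiset.induction_on with
  | empty => simp [fprod]
  | cons z R ih =>
    have e : fprod (z ::ₘ R) = (1 - PowerSeries.C z * PowerSeries.X) * fprod R := by simp [fprod]
    have hd : PowerSeries.derivative ℂ (1 - PowerSeries.C z * PowerSeries.X) = - PowerSeries.C z := by
      rw [map_sub, Derivation.leibniz]
      simp [PowerSeries.derivative_C, PowerSeries.derivative_X]
    rw [e, Derivation.leibniz, hd, Multiset.map_cons, Multiset.sum_cons, Multiset.card_cons]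
    simp only [smul_eq_mul]
    push_cast
    linear_combination (1 - PowerSeries.C z * PowerSeries.X) * ih - fprod R * geo_mul z

lemma reverse_prod (R : Multiset ℂ) :
    ((((R.map fun z => X - C z).prod).reverse : ℂ[X]) : PowerSeries ℂ) = fprod R := by
  induction R using Multiset.induction_on with
  | empty =>
    have : (1 : ℂ[X]).reverse = 1 := by rw [← C_1, reverse_C]
    simp [fprod, this]
  | cons z R ih =>
    have e : fprod (z ::ₘ R) = (1 - PowerSeries.C z * PowerSeries.X) * fprod R := by simp [fprod]
    have h : (X - C z).reverse = 1 - C z * X := by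
      rw [sub_eq_add_neg, ← C_neg, reverse_add_C, natDegree_X]
      have : (X : ℂ[X]).reverse = 1 := by
        rw [← one_mul X, reverse_mul_X, ← C_1, reverse_C]
      rw [this]; simp [sub_eq_add_neg]
    rw [Multiset.map_cons, Multiset.prod_cons, reverse_mul_of_domain, h, e, ← ih]
    push_cast
    simp

noncomputable def phi (f : ℝ[X]) (m : ℕ) : ℝ := if m ≤ f.natDegree then f.coeff (f.natDegree - m) else 0

lemma reverse_coeff_phi (f : ℝ[X]) (m : ℕ) : f.reverse.coeff m = phi f m := by
  rw [coeff_reverse, phi]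
  split_ifs with h
  · rw [revAt_le h]
  · rw [revAt_eq_self_of_lt (by omega), coeff_eq_zero_of_natDegree_lt (by omega)]

lemma map_reverse' (f : ℝ[X]) : (f.map (algebraMap ℝ ℂ)).reverse = f.reverse.map (algebraMap ℝ ℂ) := by
  ext m
  simp [coeff_reverse]

lemma newton (f : ℝ[X]) (m : ℕ) :
    ∑ p ∈ Finset.HasAntidiagonal.antidiagonal m, phi f p.1 * ellR (rootsC f) (X ^ p.2) =
      ((f.natDegree : ℝ) - m) * phi f m := by
  set fC := f.map (algebraMap ℝ ℂ) with hfC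
  have hsp : fC.Splits := IsAlgClosed.splits fC
  have hprod := hsp.eq_prod_roots
  have hcard : (rootsC f).card = f.natDegree := by
    rw [rootsC, ← hfC, ← hsp.natDegree_eq_card_roots, natDegree_map]
  have hrev : (fC.reverse : PowerSeries ℂ) = PowerSeries.C fC.leadingCoeff * fprod (rootsC f) := by
    conv_lhs => rw [hprod]
    rw [reverse_mul_of_domain, reverse_C]
    push_cast
    rw [reverse_prod]; rfl
  have key : (f.natDegree : PowerSeries ℂ) * (fC.reverse : PowerSeries ℂ) -
      PowerSeries.X * PowerSeries.derivative ℂ (fC.reverse : PowerSeries ℂ) =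
      (fC.reverse : PowerSeries ℂ) * ((rootsC f).map geo).sum := by
    rw [hrev, Derivation.leibniz, PowerSeries.derivative_C, ← hcard]
    simp only [smul_eq_mul]
    linear_combination (PowerSeries.C fC.leadingCoeff) * newton_ps (rootsC f)
  have hco : ∀ m, PowerSeries.coeff m (fC.reverse : PowerSeries ℂ) = ((phi f m : ℝ) : ℂ) := by
    intro m
    rw [Polynomial.coeff_coe, hfC, map_reverse', coeff_map, reverse_coeff_phi]; rfl
  have hgeo : ∀ j, (PowerSeries.coeff j ((rootsC f).map geo).sum).re = ellR (rootsC f) (X ^ j) := by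
    intro j
    rw [map_multiset_sum, Multiset.map_map, ellR_apply, re_msum]
    simp [geo]
  have h1 := congrArg (fun s : PowerSeries ℂ => (PowerSeries.coeff m s).re) key
  simp only [PowerSeries.coeff_mul, Complex.re_sum, hco, Complex.re_ofReal_mul, hgeo] at h1
  rw [← h1]
  have h2 : PowerSeries.coeff m (PowerSeries.X * PowerSeries.derivative ℂ (fC.reverse : PowerSeries ℂ)) = 
     (m : ℂ) * (phi f m : ℝ) := by
    cases m with
    | zero => simp
    | succ m => rw [PowerSeries.coeff_succ_X_mul, PowerSeries.coeff_derivative, hco]; push_cast; ring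
  have h3 : PowerSeries.coeff m ((f.natDegree : PowerSeries ℂ) * (fC.reverse : PowerSeries ℂ)) = 
     (f.natDegree : ℂ) * (phi f m : ℝ) := by
    rw [← map_natCast (PowerSeries.C (R := ℂ)), PowerSeries.coeff_C_mul, hco]
  rw [map_sub, h2, h3]
  simp
  ring

lemma disc_even (f : ℝ[X]) (i c : ℕ) :
    discEntry f.natDegree f (2 * i) c = if i ≤ c then phi f (c - i) else 0 := by
  have h1 : 2 * i % 2 = 0 := by omega
  have h2 : 2 * i / 2 = i := by omega
  simp only [discEntry, phi, h1, h2, if_true]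
  by_cases hic : i ≤ c
  · by_cases h : c ≤ i + f.natDegree
    · rw [if_pos ⟨hic, h⟩, if_pos hic, if_pos (by omega)]
    · rw [if_neg (by omega), if_pos hic, if_neg (by omega)]
  · rw [if_neg (by omega), if_neg hic]

lemma disc_odd (f : ℝ[X]) (i c : ℕ) :
    discEntry f.natDegree f (2 * i + 1) c =
      if i + 1 ≤ c then ((f.natDegree : ℝ) - (c - (i + 1) : ℕ)) * phi f (c - (i + 1)) else 0 := by
  have h1 : ¬ (2 * i + 1) % 2 = 0 := by omega
  have h2 : (2 * i + 1) / 2 = i := by omega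
  simp only [discEntry, phi, h2, if_neg h1]
  by_cases hic : i + 1 ≤ c
  · by_cases h : c ≤ i + f.natDegree
    · rw [if_pos ⟨hic, h⟩, if_pos hic, if_pos (by omega), Nat.cast_sub (by omega)]
    · rw [if_neg (by omega), if_pos hic]
      by_cases h' : c - (i + 1) ≤ f.natDegree
      · have : c - (i + 1) = f.natDegree := by omega
        simp [this]
      · simp [h']
  · rw [if_neg (by omega), if_neg hic]

noncomputable def Aent (l : ℝ[X] →ₗ[ℝ] ℝ) (r c : ℕ) : ℝ :=
  if r % 2 = 0 then (if c = r / 2 then 1 else 0)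
  else if r / 2 + 1 ≤ c then l (X ^ (c - (r / 2 + 1))) else 0

noncomputable def Tent (f : ℝ[X]) (r c : ℕ) : ℝ := if r ≤ c then phi f (c - r) else 0

lemma disc_factor (f : ℝ[X]) (K r c : ℕ) (hr : r < K) (hc : c < K) :
    discEntry f.natDegree f r c =
      ∑ b ∈ Finset.range K, Aent (ellR (rootsC f)) r b * Tent f b c := by
  rcases Nat.even_or_odd' r with ⟨i, rfl | rfl⟩
  · rw [disc_even]
    have h1 : 2 * i % 2 = 0 := by omega
    have h2 : 2 * i / 2 = i := by omega
    simp only [Aent, h1, h2, if_true]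
    rw [Finset.sum_eq_single i]
    · simp [Tent]
    · intro b _ hb; simp [hb]
    · intro h; exact absurd (Finset.mem_range.2 (by omega)) h
  · rw [disc_odd]
    have h1 : ¬ (2 * i + 1) % 2 = 0 := by omega
    have h2 : (2 * i + 1) / 2 = i := by omega
    simp only [Aent, h2, if_neg h1]
    split_ifs with hic
    · rw [← newton, Finset.Nat.sum_antidiagonal_eq_sum_range_succ
        (fun a b => phi f a * ellR (rootsC f) (X ^ b))]
      symm
      rw [← Finset.sum_subset (s₁ := Finset.Ico (i + 1) (c + 1))]
      · rw [Finset.sum_Ico_eq_sum_range, ← Finset.sum_range_reflect]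
        have : c + 1 - (i + 1) = (c - (i + 1)).succ := by omega
        rw [this]
        refine Finset.sum_congr rfl fun j hj => ?_
        have := Finset.mem_range.1 hj
        have hb : i + 1 + ((c - (i + 1)).succ - 1 - j) = c - j := by omega
        have hb1 : i + 1 ≤ c - j := by omega
        have hb2 : c - j ≤ c := by omega
        have hb3 : c - (c - j) = j := by omega
        have hb4 : c - j - (i + 1) = c - (i + 1) - j := by omega
        rw [hb, Tent, if_pos hb1, if_pos hb2, mul_comm, hb3, hb4]
      · intro b hb; simp at hb ⊢; omega
      · intro b _ hb
        rw [Finset.mem_Ico, not_and_or] at hb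
        rcases hb with hb | hb
        · rw [if_neg hb, zero_mul]
        · rw [Tent, if_neg (show ¬ b ≤ c by omega), mul_zero]
    · symm
      refine Finset.sum_eq_zero fun b _ => ?_
      split_ifs with h
      · rw [Tent, if_neg (by omega), mul_zero]
      · simp

def foldFun (k : ℕ) (c : Fin (2 * k)) : Fin (2 * k) :=
  ⟨if (c : ℕ) < k then 2 * c else 4 * k - 1 - 2 * c, by have := c.2; split_ifs <;> omega⟩

lemma foldFun_inj (k : ℕ) : Function.Injective (foldFun k) := by
  intro a b h
  have h1 := congrArg Fin.val h
  simp only [foldFun] at h1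
  have := a.2; have := b.2
  apply Fin.ext
  split_ifs at h1 <;> omega

noncomputable def foldPerm (k : ℕ) : Equiv.Perm (Fin (2 * k)) :=
  Equiv.ofBijective (foldFun k) (Finite.injective_iff_bijective.1 (foldFun_inj k))

lemma foldPerm_sign (k : ℕ) : Equiv.Perm.sign (foldPerm k) = 1 := by
  rw [Equiv.Perm.sign_eq_prod_prod_Iio]
  refine Finset.prod_eq_one fun j _ => ?_
  have h1 : ∀ i ∈ Finset.Iio j, (if foldPerm k i < foldPerm k j then (1 : ℤˣ) else -1) =
      if (i : ℕ) + j < 2 * k then 1 else -1 := by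
    intro i hi
    have hij : i < j := Finset.mem_Iio.1 hi
    rw [Fin.lt_def] at hij
    have hj := j.2
    congr 1
    apply propext
    change (foldFun k i : ℕ) < (foldFun k j : ℕ) ↔ _
    simp only [foldFun]
    split_ifs <;> omega
  rw [Finset.prod_congr rfl h1]
  have h2 : ∏ i ∈ Finset.Iio j, (if (i : ℕ) + j < 2 * k then (1 : ℤˣ) else -1) =
      ∏ i ∈ Finset.range j, (if (i : ℕ) + j < 2 * k then (1 : ℤˣ) else -1) := by
    rw [← Nat.Iio_eq_range, ← Fin.map_valEmbedding_Iio, Finset.prod_map]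
    rfl
  rw [h2, Finset.prod_ite, Finset.prod_const_one, one_mul, Finset.prod_const]
  have h3 : ((Finset.range j).filter fun i => ¬ i + (j : ℕ) < 2 * k) = Finset.Ico (2 * k - j) j := by
    ext i; simp; omega
  rw [h3, Nat.card_Ico]
  apply Even.neg_one_pow
  have := j.2
  rcases le_total (j : ℕ) k with h | h
  · rw [Nat.sub_eq_zero_of_le (by omega)]; exact Even.zero
  · exact ⟨j - k, by omega⟩

lemma det_A (l : ℝ[X] →ₗ[ℝ] ℝ) (k : ℕ) :
    (Matrix.of fun i j : Fin (2 * k) => Aent l i j).det = (hank l k).det := by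
  set A := Matrix.of fun i j : Fin (2 * k) => Aent l i j with hA
  have h1 := Matrix.det_permute (foldPerm k) A
  rw [foldPerm_sign] at h1
  simp only [Units.val_one, Int.cast_one, one_mul] at h1
  rw [← h1]
  let e : Fin k ⊕ Fin k ≃ Fin (2 * k) := finSumFinEquiv.trans (finCongr (two_mul k).symm)
  rw [← Matrix.det_submatrix_equiv_self e]
  have h2 : (A.submatrix (foldPerm k) id).submatrix e e =
      Matrix.fromBlocks 1 0 (Matrix.of fun i j : Fin k => A (foldPerm k (e (Sum.inr i))) (e (Sum.inl j)))
        (hank l k) := by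
    ext i j
    rcases i with i | i <;> rcases j with j | j
    · have hi := i.2
      simp [A, Aent, e, foldPerm, foldFun, Matrix.one_apply, Fin.ext_iff, eq_comm]
    · have hi := i.2
      simp [A, Aent, e, foldPerm, foldFun]
      omega
    · rfl
    · have hi := i.2
      have hj := j.2
      have a1 : ¬ (4 * k - 1 - 2 * (k + (i : ℕ))) % 2 = 0 := by omega
      have a2 : (4 * k - 1 - 2 * (k + (i : ℕ))) / 2 + 1 = k - i := by omega
      have a3 : ((foldPerm k (e (Sum.inr i)) : Fin (2 * k)) : ℕ) = 4 * k - 1 - 2 * (k + (i : ℕ)) := by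
        have a5 : ((e (Sum.inr i) : Fin (2 * k)) : ℕ) = k + i := rfl
        change (if ((e (Sum.inr i) : Fin (2 * k)) : ℕ) < k then _ else _) = _
        rw [a5, if_neg (by omega)]
      have a4 : ((e (Sum.inr j) : Fin (2 * k)) : ℕ) = k + j := rfl
      change Aent l (foldPerm k (e (Sum.inr i)) : Fin (2 * k)) (e (Sum.inr j) : Fin (2 * k)) = l (X ^ ((i : ℕ) + j))
      rw [a3, a4, Aent, if_neg a1, a2, if_pos (by omega)]
      congr 2; omega
  rw [h2, Matrix.det_fromBlocks_zero₁₂, Matrix.det_one, one_mul]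

lemma discSeq_eq (f : ℝ[X]) (k : ℕ) :
    discSeq f.natDegree f k = (hank (ellR (rootsC f)) k).det * f.leadingCoeff ^ (2 * k) := by
  have h : (Matrix.of fun i j : Fin (2 * k) => discEntry f.natDegree f i j) =
      (Matrix.of fun i j : Fin (2 * k) => Aent (ellR (rootsC f)) i j) *
      (Matrix.of fun i j : Fin (2 * k) => Tent f i j) := by
    ext i j
    rw [Matrix.mul_apply, Matrix.of_apply, disc_factor f (2 * k) i j i.2 j.2, Finset.sum_range]
    rfl
  rw [discSeq, h, Matrix.det_mul, det_A]
  congr 1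
  rw [Matrix.det_of_isUpperTriangular]
  · simp [Tent, phi]
  · intro i j hij
    have : (j : ℕ) < i := hij
    simp only [Matrix.of_apply, Tent]
    rw [if_neg (by omega)]

lemma mul_neg_iff_neg_of_pos_right' {a b : ℝ} (hb : 0 < b) : a * b < 0 ↔ a < 0 := by
  constructor
  · intro h; by_contra! h'; nlinarith
  · intro h; nlinarith

lemma sign_disc {f : ℝ[X]} (hf : f ≠ 0) (k : ℕ) :
    signOf (discSeq f.natDegree f k) = signOf (hank (ellR (rootsC f)) k).det := by
  rw [discSeq_eq]
  have : 0 < f.leadingCoeff ^ (2 * k) := by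
    rw [pow_mul]; have := leadingCoeff_ne_zero.2 hf; positivity
  simp only [signOf, mul_pos_iff_of_pos_right this, mul_neg_iff_neg_of_pos_right' this]

noncomputable def sg (l : ℝ[X] →ₗ[ℝ] ℝ) (k : ℕ) : ℤ := signOf (hank l k).det

lemma signOf_ne_zero (x : ℝ) : signOf x ≠ 0 ↔ x ≠ 0 := by
  unfold signOf
  split_ifs with h1 h2
  · simpa using h1.ne'
  · simpa using h2.ne
  · simp; linarith

lemma sg_inertia {l : ℝ[X] →ₗ[ℝ] ℝ} {k ν : ℕ} (h : Inertia l k ν) : sg l k = (-1) ^ ν := by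
  have h2 := h.2
  unfold sg signOf
  rcases Nat.even_or_odd ν with hν | hν
  · rw [hν.neg_one_pow] at h2 ⊢
    rw [if_pos (by linarith)]
  · rw [hν.neg_one_pow] at h2 ⊢
    rw [if_neg (by linarith), if_pos (by linarith)]

lemma revised_of_ne (s : List ℤ) (p : ℕ) (h : s.getD p 0 ≠ 0) : revisedEntry s p = s.getD p 0 := by
  simp only [revisedEntry]
  rw [if_pos h]

lemma revised_trailing (s : List ℤ) (p : ℕ) (h : ∀ j, p ≤ j → s.getD j 0 = 0) :
    revisedEntry s p = 0 := by
  simp only [revisedEntry]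
  rw [if_neg (not_not.2 (h p le_rfl)), if_neg]
  rintro ⟨_, j, _, hj, h2⟩
  exact h2 (h j hj.le)

lemma revised_internal (s : List ℤ) (m p j : ℕ) (hm : s.getD m 0 ≠ 0) (hmp : m < p)
    (hz : ∀ i, m < i → i ≤ p → s.getD i 0 = 0) (hpj : p < j) (hj : s.getD j 0 ≠ 0) :
    revisedEntry s p = (-1) ^ ((p - m + 1) / 2) * s.getD m 0 := by
  have hjl : j < s.length := by
    by_contra! h
    exact hj (List.getD_eq_default _ _ h)
  simp only [revisedEntry]
  rw [if_neg (not_not.2 (hz p hmp le_rfl)), if_pos ⟨⟨m, hmp, hm⟩, ⟨j, hjl, hpj, hj⟩⟩]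
  have : ∀ (_ : DecidablePred fun i => s.getD i 0 ≠ 0),
      Nat.findGreatest (fun i => s.getD i 0 ≠ 0) p = m := by
    intro _
    rw [Nat.findGreatest_eq_iff]
    exact ⟨hmp.le, fun _ => hm, fun i h1 h2 => not_not.2 (hz i h1 h2)⟩
  rw [this]

noncomputable def chg (u : ℕ → ℤ) (m : ℕ) : ℕ :=
  (List.range m).countP fun p => decide (u p * u (p + 1) < 0)

lemma chg_succ (u : ℕ → ℤ) (m : ℕ) : chg u (m + 1) = chg u m + if u m * u (m + 1) < 0 then 1 else 0 := by
  simp [chg, List.range_succ, List.countP_append, List.countP_singleton]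

lemma signChanges_map (u : ℕ → ℤ) (n : ℕ) : signChanges ((List.range n).map u) = chg u (n - 1) := by
  have : ((List.range n).map u).zip ((List.range n).map u).tail =
      (List.range (n - 1)).map fun p => (u p, u (p + 1)) := by
    apply List.ext_getElem
    · simp
    · intro i h1 h2
      simp
  rw [signChanges, this, List.countP_map]
  rfl

lemma chg_trailing (u : ℕ → ℤ) (m : ℕ) (h : ∀ p, m < p → u p = 0) (j : ℕ) : chg u (m + j) = chg u m := by
  induction j with
  | zero => rfl
  | succ j ih => rw [← add_assoc, chg_succ, ih, h (m + j + 1) (by omega)]; simp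

lemma neg_one_sq_pow (a : ℕ) : ((-1 : ℤ) ^ a) * (-1) ^ a = 1 := by
  rw [← mul_pow]; simp

/-- the number of sign changes inside a gap -/
lemma chg_gap (u : ℕ → ℤ) (m d ν ν' : ℕ) (hd : 0 < d) (hm : u m = (-1) ^ ν)
    (hmd : u (m + d) = (-1) ^ ν')
    (hi : ∀ t, 0 < t → t < d → u (m + t) = (-1) ^ ((t + 1) / 2) * u m)
    (h1 : ν + d / 2 ≤ ν') (h2 : ν' ≤ ν + (d + 1) / 2) :
    chg u (m + d) + ν = chg u m + ν' := by
  have hi' : ∀ t, t < d → u (m + t) = (-1) ^ (ν + (t + 1) / 2) := by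
    intro t ht
    rcases Nat.eq_zero_or_pos t with rfl | h0
    · simpa using hm
    · rw [hi t h0 ht, hm, pow_add]; ring
  have sgn : ∀ a b : ℕ, ((-1 : ℤ) ^ a * (-1) ^ b < 0) ↔ (a + b) % 2 = 1 := by
    intro a b
    rw [← pow_add]
    rcases Nat.even_or_odd (a + b) with h | h
    · rw [h.neg_one_pow]; rw [Nat.even_iff] at h; simp [h]
    · rw [h.neg_one_pow]; rw [Nat.odd_iff] at h; simp [h]
  have key : ∀ t, t < d → chg u (m + t) = chg u m + (t + 1) / 2 := by
    intro t
    induction t with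
    | zero => intro _; simp
    | succ t ih =>
      intro ht
      rw [← add_assoc, chg_succ, ih (by omega), add_assoc m t 1, hi' t (by omega), hi' (t + 1) ht]
      simp only [sgn]
      split_ifs <;> omega
  obtain ⟨e, rfl⟩ : ∃ e, d = e + 1 := ⟨d - 1, by omega⟩
  rw [← add_assoc, chg_succ, key e (by omega), add_assoc m e 1, hi' e (by omega), hmd]
  simp only [sgn]
  split_ifs <;> omega

lemma rk_le {f : ℝ[X]} (hf : f ≠ 0) : rk f ≤ f.natDegree := by
  rw [← card_S hf]
  have h3 := Multiset.toFinset_card_le (rootsC f)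
  have h4 : (rootsC f).card ≤ _ := card_roots' (f.map (algebraMap ℝ ℂ))
  rw [natDegree_map] at h4
  omega

lemma sg_gt {f : ℝ[X]} (hf : f ≠ 0) {k : ℕ} (hk : rk f < k) : sg (ellR (rootsC f)) k = 0 := by
  rw [sg, hank_zero_of_gt hf hk]; simp [signOf]

lemma signList_getD {f : ℝ[X]} (hf : f ≠ 0) (p : ℕ) :
    (signList f.natDegree f).getD p 0 = sg (ellR (rootsC f)) (p + 1) := by
  by_cases h : p < f.natDegree
  · rw [List.getD_eq_getElem _ _ (by simpa [signList] using h)]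
    have key : ∀ a, a = p → signOf (hank (ellR (rootsC f)) (a + 1)).det
        = signOf (hank (ellR (rootsC f)) (p + 1)).det := by
      rintro a rfl
      rfl
    simp only [signList, List.getElem_map, sign_disc hf, sg]
    exact key _ (List.getElem_range _)
  · rw [List.getD_eq_default _ _ (by simpa [signList] using h), sg_gt hf]
    have := rk_le hf
    omega

lemma hank_one {f : ℝ[X]} (hn : 0 < f.natDegree) : 0 < (hank (ellR (rootsC f)) 1).det := by
  have hcard : (rootsC f).card = f.natDegree := by
    rw [rootsC, ← (IsAlgClosed.splits (f.map (algebraMap ℝ ℂ))).natDegree_eq_card_roots, natDegree_map]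
  simp [hank, ellR_apply, hcard, hn]

lemma inertia_one {f : ℝ[X]} (hn : 0 < f.natDegree) {ν : ℕ}
    (h : Inertia (ellR (rootsC f)) 1 ν) : ν = 0 := by
  have h1 := hank_one hn
  obtain ⟨⟨N, P, _, _, _, h2, _⟩, h3⟩ := h
  have : ν ≤ 1 := by omega
  interval_cases ν
  · rfl
  · rw [pow_one] at h3; linarith

lemma main_count {f : ℝ[X]} (hf : f ≠ 0) (hn : 0 < f.natDegree) (m : ℕ) :
    ∀ ν, Inertia (ellR (rootsC f)) (m + 1) ν →
      chg (revisedEntry (signList f.natDegree f)) m = ν := by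
  set l := ellR (rootsC f) with hl
  set s := signList f.natDegree f with hs
  have hget : ∀ p, s.getD p 0 = sg l (p + 1) := signList_getD hf
  induction m using Nat.strong_induction_on with
  | _ m ih =>
  intro ν hν
  rcases Nat.eq_zero_or_pos m with rfl | hm
  · rw [inertia_one hn hν]; rfl
  · classical
    let m' := Nat.findGreatest (fun i => sg l (i + 1) ≠ 0) (m - 1)
    have h0 : sg l (0 + 1) ≠ 0 := (signOf_ne_zero _).2 (hank_one hn).ne'
    have hm' : sg l (m' + 1) ≠ 0 :=
      Nat.findGreatest_spec (P := fun i => sg l (i + 1) ≠ 0) (Nat.zero_le _) h0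
    have hlt : m' ≤ m - 1 := Nat.findGreatest_le _
    have hz : ∀ i, m' < i → i ≤ m - 1 → sg l (i + 1) = 0 := fun i h1 h2 =>
      not_not.1 (Nat.findGreatest_is_greatest h1 h2)
    obtain ⟨ν', hν'⟩ := exists_inertia l (m' + 1) ((signOf_ne_zero _).1 hm')
    have ih' := ih m' (by omega) ν' hν'
    clear_value m'
    obtain ⟨d, rfl⟩ : ∃ d, m = m' + d := ⟨m - m', by omega⟩
    have hd : 0 < d := by omega
    have hsm : sg l (m' + d + 1) ≠ 0 := by
      rw [sg_inertia hν]; exact pow_ne_zero _ (by norm_num)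
    have hstep := inertia_step (d := d) hν' (by rwa [add_right_comm]) hd (by
      intro t ht
      have := hz (m' + 1 + t) (by omega) (by omega)
      by_contra hc
      exact (signOf_ne_zero _).2 hc this)
    have hum : revisedEntry s m' = (-1) ^ ν' := by
      rw [revised_of_ne _ _ (by rwa [hget]), hget, sg_inertia hν']
    have := chg_gap (revisedEntry s) m' d ν' ν hd hum
      (by rw [revised_of_ne _ _ (by rwa [hget]), hget, sg_inertia hν])
      (by
        intro t ht htd
        rw [revised_internal s m' (m' + t) (m' + d) (by rwa [hget]) (by omega)
          (fun i h1 h2 => by rw [hget]; exact hz i h1 (by omega)) (by omega) (by rwa [hget]),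
          revised_of_ne s m' (by rwa [hget]), Nat.add_sub_cancel_left])
      hstep.1 hstep.2
    omega

lemma revised_ne_iff {f : ℝ[X]} (hf : f ≠ 0) (hn : 0 < f.natDegree) (p : ℕ) :
    revisedEntry (signList f.natDegree f) p ≠ 0 ↔ p < rk f := by
  set l := ellR (rootsC f) with hl
  set s := signList f.natDegree f with hs
  have hget : ∀ p, s.getD p 0 = sg l (p + 1) := signList_getD hf
  constructor
  · intro h
    by_contra! hp
    apply h
    apply revised_trailing
    intro j hj
    rw [hget, hl, sg_gt hf (by omega)]
  · intro hp
    by_cases h0 : s.getD p 0 = 0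
    · classical
      have h1 : s.getD 0 0 ≠ 0 := by rw [hget]; exact (signOf_ne_zero _).2 (hank_one hn).ne'
      let m' := Nat.findGreatest (fun i => s.getD i 0 ≠ 0) p
      have hm' : s.getD m' 0 ≠ 0 :=
        Nat.findGreatest_spec (P := fun i => s.getD i 0 ≠ 0) (Nat.zero_le _) h1
      have hlt : m' ≤ p := Nat.findGreatest_le _
      have hz : ∀ i, m' < i → i ≤ p → s.getD i 0 = 0 := fun i h1 h2 =>
        not_not.1 (Nat.findGreatest_is_greatest h1 h2)
      have hne : m' ≠ p := by intro h; rw [h] at hm'; exact hm' h0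
      have hlast : s.getD (rk f - 1) 0 ≠ 0 := by
        rw [hget, Nat.sub_add_cancel (by omega)]
        exact (signOf_ne_zero _).2 (hank_rk_ne hf)
      have hpl : p ≠ rk f - 1 := by intro h; rw [← h] at hlast; exact hlast h0
      rw [revised_internal s m' p (rk f - 1) hm' (by omega) hz (by omega) hlast]
      exact mul_ne_zero (pow_ne_zero _ (by norm_num)) hm'
    · rw [revised_of_ne _ _ h0]; exact h0

lemma countP_lt (r n : ℕ) (h : r ≤ n) : (List.range n).countP (fun p => decide (p < r)) = r := by
  induction n with
  | zero => simp; omega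
  | succ n ih =>
    rw [List.range_succ, List.countP_append, List.countP_singleton]
    rcases Nat.lt_or_ge n r with h' | h'
    · have : r = n + 1 := by omega
      subst this
      have : (List.range n).countP (fun p => decide (p < n + 1)) = n := by
        rw [List.countP_eq_length.2]
        · simp
        · intro a ha; have := List.mem_range.1 ha; simp; omega
      rw [this]; simp
    · rw [ih h']; simp; omega

lemma final (f : ℝ[X]) (hf : f ≠ 0) :
    signChanges (revisedSignList (signList f.natDegree f)) = (upR f).card ∧
    (revisedSignList (signList f.natDegree f)).countP (fun x => decide (x ≠ 0)) = rk f := by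
  have hlen : (signList f.natDegree f).length = f.natDegree := by simp [signList]
  have hle := rk_le hf
  rw [revisedSignList, hlen, signChanges_map]
  rcases Nat.eq_zero_or_pos f.natDegree with h0 | hn
  · have h1 : rk f = 0 := by omega
    have h2 : rk f = f.roots.toFinset.card + 2 * (upR f).card := rfl
    constructor
    · rw [h0]; simp [chg]; omega
    · rw [h1, h0]; simp
  · have hr : 0 < rk f := by
      by_contra h
      exact (hank_one hn).ne' (hank_zero_of_gt hf (by omega))
    constructor
    · obtain ⟨ν, hν⟩ := exists_inertia _ _ (hank_rk_ne hf)
      rw [← inertia_rk hf hν]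
      have h1 := main_count hf hn (rk f - 1) ν (by rwa [Nat.sub_add_cancel hr])
      rw [← h1, show f.natDegree - 1 = (rk f - 1) + (f.natDegree - rk f) by omega]
      apply chg_trailing
      intro p hp
      by_contra h
      have := (revised_ne_iff hf hn p).1 h
      omega
    · rw [List.countP_map, ← countP_lt (rk f) f.natDegree hle]
      congr 1
      funext p
      simp only [Function.comp]
      rw [decide_eq_decide]
      exact revised_ne_iff hf hn p

/-- Let `f` be a real polynomial of degree `n` with nonzero leading
coefficient, and form the revised sign list of its discriminant sequence.  If `K` is
the number of sign changes and `L` the number of nonzero members of the revised sign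
list, then `f` has exactly `K` distinct pairs of complex-conjugate (non-real) roots
and exactly `L - 2K` distinct real roots. -/
theorem statement0 (n : ℕ) (f : Polynomial ℝ) (hf : f ≠ 0) (hdeg : f.natDegree = n)
    (K L : ℕ)
    (hK : K = signChanges (revisedSignList (signList n f)))
    (hL : L = (revisedSignList (signList n f)).countP fun x => decide (x ≠ 0)) :
    ((f.map (algebraMap ℝ ℂ)).roots.toFinset.filter fun z => z.im ≠ 0).card = 2 * K ∧
    (f.roots.toFinset.card : ℤ) = (L : ℤ) - 2 * (K : ℤ) := by

  subst hdeg
  obtain ⟨h1, h2⟩ := final f hf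
  rw [h1] at hK
  rw [h2] at hL
  subst hK hL
  refine ⟨card_im_ne hf, ?_⟩
  rw [rk]
  push_cast
  ring
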